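/- Let (𝒜, α) be a weighted system and λ > 0. Then ρ(𝒜, α) < λ if and only if there exists a norm ‖·‖ on ℝ^d such that, in the operator norm induced by ‖·‖, one has ‖A_j‖ < λ^{α_j} for every j = 1, …, m. -/

import Mathlib

open Filter

attribute [local instance] Matrix.linftyOpNormedRing

/-- The product `A(k)⋯A(1)` associated with the word `w = (i_1, …, i_k)`. -/
noncomputable def wordProd {d m : ℕ} (A : Fin m → Matrix (Fin d) (Fin d) ℝ)
    (w : List (Fin m)) : Matrix (Fin d) (Fin d) ℝ :=
  ((w.map A).reverse).prod

/-- The total weight `α(k)+⋯+α(1)` of the word `w = (i_1, …, i_k)`. -/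
def wordWeight {m : ℕ} (α : Fin m → ℝ) (w : List (Fin m)) : ℝ :=
  (w.map α).sum

/-- `ρ_k`: the maximum of `‖A(k)⋯A(1)‖^(1/(α(k)+⋯+α(1)))` over products of length `k`. -/
noncomputable def rhoSeq {d m : ℕ} (A : Fin m → Matrix (Fin d) (Fin d) ℝ)
    (α : Fin m → ℝ) (k : ℕ) : ℝ :=
  sSup {r : ℝ | ∃ w : List (Fin m), w.length = k ∧
    r = ‖wordProd A w‖ ^ (1 / wordWeight α w)}

/-- The `α`-weighted joint spectral radius `ρ(𝒜, α) = limsup_{k→∞} ρ_k`. -/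
noncomputable def wjsr {d m : ℕ} (A : Fin m → Matrix (Fin d) (Fin d) ℝ)
    (α : Fin m → ℝ) : ℝ :=
  limsup (rhoSeq A α) atTop

lemma wordProd_nil {d m : ℕ} (A : Fin m → Matrix (Fin d) (Fin d) ℝ) : wordProd A [] = 1 := by
  simp [wordProd]

lemma wordProd_cons {d m : ℕ} (A : Fin m → Matrix (Fin d) (Fin d) ℝ) (j : Fin m)
    (w : List (Fin m)) : wordProd A (j :: w) = wordProd A w * A j := by
  simp [wordProd]

lemma wordWeight_nil {m : ℕ} (α : Fin m → ℝ) : wordWeight α [] = 0 := by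
  simp [wordWeight]

lemma wordWeight_cons {m : ℕ} (α : Fin m → ℝ) (j : Fin m) (w : List (Fin m)) :
    wordWeight α (j :: w) = α j + wordWeight α w := by
  simp [wordWeight]

lemma length_mul_le_wordWeight {m : ℕ} {α : Fin m → ℝ} {a : ℝ} (ha : ∀ j, a ≤ α j)
    (w : List (Fin m)) : (w.length : ℝ) * a ≤ wordWeight α w := by
  induction w with
  | nil => simp [wordWeight_nil]
  | cons j w ih =>
    rw [wordWeight_cons, List.length_cons]
    push_cast
    linarith [ha j]

lemma exists_pos_forall_le {m : ℕ} {α : Fin m → ℝ} (hα : ∀ i, 0 < α i) :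
    ∃ a : ℝ, 0 < a ∧ ∀ j, a ≤ α j := by
  have h : ∀ᶠ a in nhdsWithin (0 : ℝ) (Set.Ioi 0), ∀ j, a ≤ α j :=
    eventually_all.2 fun j =>
      ((eventually_lt_nhds (hα j)).filter_mono nhdsWithin_le_nhds).mono fun _ h => h.le
  obtain ⟨a, ha, hpos⟩ := (h.and self_mem_nhdsWithin).exists
  exact ⟨a, hpos, ha⟩

lemma finite_rhoSeq_set {d m : ℕ} (A : Fin m → Matrix (Fin d) (Fin d) ℝ) (α : Fin m → ℝ)
    (k : ℕ) : {r : ℝ | ∃ w : List (Fin m), w.length = k ∧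
      r = ‖wordProd A w‖ ^ (1 / wordWeight α w)}.Finite := by
  refine ((List.finite_length_eq (Fin m) k).image
    fun w => ‖wordProd A w‖ ^ (1 / wordWeight α w)).subset ?_
  rintro r ⟨w, hw, rfl⟩
  exact ⟨w, hw, rfl⟩

lemma rhoSeq_nonneg {d m : ℕ} (A : Fin m → Matrix (Fin d) (Fin d) ℝ) (α : Fin m → ℝ)
    (k : ℕ) : 0 ≤ rhoSeq A α k := by
  refine Real.sSup_nonneg ?_
  rintro r ⟨w, -, rfl⟩
  positivity

lemma isCoboundedUnder_rhoSeq {d m : ℕ} (A : Fin m → Matrix (Fin d) (Fin d) ℝ)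
    (α : Fin m → ℝ) : IsCoboundedUnder (· ≤ ·) atTop (rhoSeq A α) :=
  IsBoundedUnder.isCoboundedUnder_le
    (isBoundedUnder_of ⟨0, fun k => rhoSeq_nonneg A α k⟩)

/-- A uniform exponential bound `C * μ ^ weight` on products bounds `ρ_k` asymptotically by `μ`. -/
lemma eventually_rhoSeq_le {d m : ℕ} {A : Fin m → Matrix (Fin d) (Fin d) ℝ} {α : Fin m → ℝ}
    (hα : ∀ i, 0 < α i) {C μ ν : ℝ} (hC : 1 ≤ C) (hμ : 0 < μ) (hν : μ < ν)
    (h : ∀ w, ‖wordProd A w‖ ≤ C * μ ^ wordWeight α w) :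
    ∀ᶠ k in atTop, rhoSeq A α k ≤ ν := by
  obtain ⟨a, ha, haα⟩ := exists_pos_forall_le hα
  have hC0 : 0 < C := one_pos.trans_le hC
  have hlim : Tendsto (fun k : ℕ => C ^ (1 / ((k : ℝ) * a)) * μ) atTop (nhds μ) := by
    have h0 : Tendsto (fun k : ℕ => 1 / ((k : ℝ) * a)) atTop (nhds 0) :=
      tendsto_const_nhds.div_atTop (tendsto_natCast_atTop_atTop.atTop_mul_const ha)
    have h1 := ((Real.continuous_const_rpow hC0.ne').tendsto 0).comp h0
    simpa using h1.mul_const μ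
  filter_upwards [hlim.eventually (eventually_lt_nhds hν), eventually_gt_atTop 0] with k hk hk0
  refine Real.sSup_le ?_ (hμ.trans hν).le
  rintro r ⟨w, hw, rfl⟩
  have hka : 0 < (k : ℝ) * a := by positivity
  have hW : (k : ℝ) * a ≤ wordWeight α w := hw ▸ length_mul_le_wordWeight haα w
  have hW0 : 0 < wordWeight α w := hka.trans_le hW
  calc ‖wordProd A w‖ ^ (1 / wordWeight α w)
      ≤ (C * μ ^ wordWeight α w) ^ (1 / wordWeight α w) :=
        Real.rpow_le_rpow (norm_nonneg _) (h w) (by positivity)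
    _ = C ^ (1 / wordWeight α w) * μ := by
        rw [Real.mul_rpow hC0.le (by positivity), ← Real.rpow_mul hμ.le,
          mul_one_div_cancel hW0.ne', Real.rpow_one]
    _ ≤ C ^ (1 / ((k : ℝ) * a)) * μ := by
        gcongr
    _ ≤ ν := hk.le

lemma isBoundedUnder_rhoSeq {d m : ℕ} (A : Fin m → Matrix (Fin d) (Fin d) ℝ) {α : Fin m → ℝ}
    (hα : ∀ i, 0 < α i) : IsBoundedUnder (· ≤ ·) atTop (rhoSeq A α) := by
  have h : ∀ᶠ μ : ℝ in atTop, ∀ j, ‖A j‖ ≤ μ ^ α j :=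
    eventually_all.2 fun j => (tendsto_rpow_atTop (hα j)).eventually_ge_atTop _
  obtain ⟨μ, hμ, hμ0⟩ := (h.and (eventually_gt_atTop 0)).exists
  refine ⟨μ + 1, eventually_map.2 <| eventually_rhoSeq_le hα
    (C := max 1 ‖(1 : Matrix (Fin d) (Fin d) ℝ)‖)
    (le_max_left _ _) hμ0 (lt_add_one μ) fun w => ?_⟩
  induction w with
  | nil => simp [wordProd_nil, wordWeight_nil]
  | cons j w ih =>
    rw [wordProd_cons, wordWeight_cons, Real.rpow_add hμ0, mul_comm (μ ^ α j), ← mul_assoc]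
    exact (norm_mul_le _ _).trans (by gcongr; exact hμ j)

lemma Seminorm.exists_norm_equiv {E : Type*} [NormedAddCommGroup E] [NormedSpace ℝ E]
    [FiniteDimensional ℝ E] (N : Seminorm ℝ E) (hN : ∀ x, x ≠ 0 → 0 < N x) :
    ∃ a b : ℝ, 0 < a ∧ 0 < b ∧ ∀ x, a * ‖x‖ ≤ N x ∧ N x ≤ b * ‖x‖ := by
  have hcont : Continuous N := by
    have := N.convexOn.continuousOn isOpen_univ
    exact continuousOn_univ.1 this
  obtain ⟨b, hb, hNb⟩ := N.bound_of_continuous_normedSpace hcont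
  rcases subsingleton_or_nontrivial E with hE | hE
  · refine ⟨1, 1, one_pos, one_pos, fun x => ?_⟩
    simp [Subsingleton.elim x 0]
  obtain ⟨y, hy, hmin⟩ := (isCompact_sphere (0 : E) 1).exists_isMinOn
    (NormedSpace.sphere_nonempty.2 zero_le_one) hcont.continuousOn
  have hy0 : y ≠ 0 := by
    rintro rfl
    simp at hy
  refine ⟨N y, b, hN y hy0, hb, fun x => ⟨?_, hNb x⟩⟩
  rcases eq_or_ne x 0 with rfl | hx
  · simp
  have hx' : 0 < ‖x‖ := norm_pos_iff.2 hx
  have hmem : ‖x‖⁻¹ • x ∈ Metric.sphere (0 : E) 1 := by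
    simp [norm_smul, hx'.ne']
  have hle : N y ≤ N (‖x‖⁻¹ • x) := hmin hmem
  rw [map_smul_eq_mul, norm_inv, norm_norm] at hle
  calc N y * ‖x‖ ≤ ‖x‖⁻¹ * N x * ‖x‖ := by gcongr
    _ = N x := by field_simp

lemma Matrix.linftyOpNorm_le_of_forall_mulVec_le {d : ℕ} (M : Matrix (Fin d) (Fin d) ℝ) {C : ℝ}
    (hC : 0 ≤ C) (h : ∀ x : Fin d → ℝ, ‖M.mulVec x‖ ≤ C * ‖x‖) : ‖M‖ ≤ C := by
  have := Matrix.linfty_opNorm_eq_opNorm M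
  refine this.trans_le (ContinuousLinearMap.opNorm_le_bound _ hC fun x => ?_)
  exact h x

/-- An extremal-type seminorm: the supremum of `μ ^ (-weight) * ‖A(k)⋯A(1) x‖` over all words. -/
lemma exists_seminorm_of_wordProd_bound {d m : ℕ} {A : Fin m → Matrix (Fin d) (Fin d) ℝ}
    {α : Fin m → ℝ} {C μ : ℝ} (hμ : 0 < μ)
    (h : ∀ w, ‖wordProd A w‖ ≤ C * μ ^ wordWeight α w) :
    ∃ N : Seminorm ℝ (Fin d → ℝ), (∀ x, ‖x‖ ≤ N x) ∧
      ∀ j x, N ((A j).mulVec x) ≤ μ ^ α j * N x := by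
  let f (x : Fin d → ℝ) (w : List (Fin m)) : ℝ :=
    ‖(wordProd A w).mulVec x‖ / μ ^ wordWeight α w
  have hf0 : ∀ x w, 0 ≤ f x w := fun x w => by positivity
  have hbdd : ∀ x, BddAbove (Set.range (f x)) := by
    intro x
    refine ⟨C * ‖x‖, ?_⟩
    rintro _ ⟨w, rfl⟩
    refine (div_le_iff₀ (by positivity)).2 ?_
    calc ‖(wordProd A w).mulVec x‖ ≤ ‖wordProd A w‖ * ‖x‖ := Matrix.linfty_opNorm_mulVec _ _
      _ ≤ C * μ ^ wordWeight α w * ‖x‖ := by gcongr; exact h w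
      _ = C * ‖x‖ * μ ^ wordWeight α w := by ring
  have hle : ∀ x w, f x w ≤ ⨆ w, f x w := fun x w => le_ciSup (hbdd x) w
  refine ⟨Seminorm.of (fun x => ⨆ w, f x w) (fun x y => ?_) (fun c x => ?_), fun x => ?_,
    fun j x => ?_⟩
  · refine ciSup_le fun w => ?_
    refine le_trans ?_ (add_le_add (hle x w) (hle y w))
    simp only [f, Matrix.mulVec_add, ← add_div]
    gcongr
    exact norm_add_le _ _
  · simp only [f, Matrix.mulVec_smul, norm_smul, mul_div_assoc]
    exact (Real.mul_iSup_of_nonneg (norm_nonneg c) _).symm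
  · change ‖x‖ ≤ ⨆ w, f x w
    simpa [f, wordProd_nil, wordWeight_nil] using hle x []
  · change (⨆ w, f ((A j).mulVec x) w) ≤ μ ^ α j * ⨆ w, f x w
    refine ciSup_le fun w => ?_
    refine le_trans (le_of_eq ?_) (mul_le_mul_of_nonneg_left (hle x (j :: w)) (by positivity))
    simp only [f, wordProd_cons, wordWeight_cons, Matrix.mulVec_mulVec, Real.rpow_add hμ]
    field_simp

lemma exists_wordProd_bound_of_wjsr_lt {d m : ℕ} {A : Fin m → Matrix (Fin d) (Fin d) ℝ}
    {α : Fin m → ℝ} (hα : ∀ i, 0 < α i) {μ : ℝ} (hμ : 0 < μ) (h : wjsr A α < μ) :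
    ∃ C : ℝ, ∀ w, ‖wordProd A w‖ ≤ C * μ ^ wordWeight α w := by
  obtain ⟨a, ha, haα⟩ := exists_pos_forall_le hα
  obtain ⟨K, hK⟩ := eventually_atTop.1 <|
    (eventually_lt_of_limsup_lt h (isBoundedUnder_rhoSeq A hα)).and (eventually_gt_atTop 0)
  obtain ⟨C, hC⟩ := ((List.finite_length_lt (Fin m) K).image
    fun w => ‖wordProd A w‖ / μ ^ wordWeight α w).bddAbove
  refine ⟨max 1 C, fun w => ?_⟩
  rcases lt_or_ge w.length K with hw | hw
  · have := hC ⟨w, hw, rfl⟩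
    exact (div_le_iff₀ (by positivity)).1 (this.trans (le_max_right _ _))
  · obtain ⟨hρ, hpos⟩ := hK _ hw
    have hW : 0 < wordWeight α w :=
      lt_of_lt_of_le (by positivity) (length_mul_le_wordWeight haα w)
    have hle : ‖wordProd A w‖ ^ (1 / wordWeight α w) ≤ μ :=
      (le_csSup (finite_rhoSeq_set A α _).bddAbove ⟨w, rfl, rfl⟩).trans hρ.le
    calc ‖wordProd A w‖ = (‖wordProd A w‖ ^ (1 / wordWeight α w)) ^ wordWeight α w := by
          rw [← Real.rpow_mul (norm_nonneg _), one_div_mul_cancel hW.ne', Real.rpow_one]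
      _ ≤ 1 * μ ^ wordWeight α w := by
          rw [one_mul]
          gcongr
      _ ≤ max 1 C * μ ^ wordWeight α w := by
          gcongr
          exact le_max_left _ _

lemma exists_norm_of_wjsr_lt {d m : ℕ} {A : Fin m → Matrix (Fin d) (Fin d) ℝ}
    {α : Fin m → ℝ} (hα : ∀ i, 0 < α i) {lam : ℝ} (hlam : 0 < lam)
    (h : wjsr A α < lam) :
    ∃ N : Seminorm ℝ (Fin d → ℝ), (∀ x : Fin d → ℝ, x ≠ 0 → 0 < N x) ∧
      ∀ j : Fin m,
        sSup {c : ℝ | ∃ x : Fin d → ℝ, N x = 1 ∧ c = N ((A j).mulVec x)} < lam ^ α j := by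
  obtain ⟨μ, hμ, hμlam⟩ := exists_between (max_lt h hlam)
  have hμ0 : 0 < μ := (le_max_right _ _).trans_lt hμ
  obtain ⟨C, hC⟩ := exists_wordProd_bound_of_wjsr_lt hα hμ0 ((le_max_left _ _).trans_lt hμ)
  obtain ⟨N, hN, hNA⟩ := exists_seminorm_of_wordProd_bound hμ0 hC
  refine ⟨N, fun x hx => (norm_pos_iff.2 hx).trans_le (hN x), fun j => ?_⟩
  refine lt_of_le_of_lt (Real.sSup_le ?_ (by positivity))
    (Real.rpow_lt_rpow hμ0.le hμlam (hα j))
  rintro c ⟨x, hx, rfl⟩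
  simpa [hx] using hNA j x

lemma exists_lt_forall_le_rpow {m : ℕ} {c α : Fin m → ℝ} {lam : ℝ} (hlam : 0 < lam)
    (h : ∀ j, c j < lam ^ α j) : ∃ μ, 0 < μ ∧ μ < lam ∧ ∀ j, c j ≤ μ ^ α j := by
  have h1 : ∀ᶠ μ in nhds lam, ∀ j, c j ≤ μ ^ α j := eventually_all.2 fun j =>
    ((Real.continuousAt_rpow_const lam (α j) (Or.inl hlam.ne')).eventually
      (eventually_gt_nhds (h j))).mono fun _ h => h.le
  obtain ⟨μ, ⟨h2, h3⟩, h4⟩ := (((h1.and (eventually_gt_nhds hlam)).filter_mono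
    nhdsWithin_le_nhds).and (self_mem_nhdsWithin (s := Set.Iio lam))).exists
  exact ⟨μ, h3, h4, h2⟩

lemma wjsr_lt_of_norm {d m : ℕ} {A : Fin m → Matrix (Fin d) (Fin d) ℝ}
    {α : Fin m → ℝ} (hα : ∀ i, 0 < α i) {lam : ℝ} (hlam : 0 < lam)
    (N : Seminorm ℝ (Fin d → ℝ)) (hN : ∀ x : Fin d → ℝ, x ≠ 0 → 0 < N x)
    (h : ∀ j : Fin m,
      sSup {c : ℝ | ∃ x : Fin d → ℝ, N x = 1 ∧ c = N ((A j).mulVec x)} < lam ^ α j) :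
    wjsr A α < lam := by
  obtain ⟨μ, hμ, hμlam, hle⟩ := exists_lt_forall_le_rpow hlam h
  obtain ⟨a, b, ha, hb, hab⟩ := N.exists_norm_equiv hN
  have hA : ∀ j x, N ((A j).mulVec x) ≤ μ ^ α j * N x := by
    intro j x
    rcases eq_or_ne x 0 with rfl | hx
    · simp
    have hNx := hN x hx
    have hbdd : BddAbove {c : ℝ | ∃ x : Fin d → ℝ, N x = 1 ∧ c = N ((A j).mulVec x)} := by
      refine ⟨b * (‖A j‖ * (1 / a)), ?_⟩
      rintro c ⟨y, hy, rfl⟩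
      have hy' : ‖y‖ ≤ 1 / a := by
        rw [le_div_iff₀ ha, mul_comm, ← hy]
        exact (hab y).1
      refine (hab _).2.trans ?_
      gcongr
      exact (Matrix.linfty_opNorm_mulVec _ _).trans (by gcongr)
    have h1 : N ((A j).mulVec ((N x)⁻¹ • x)) ≤ μ ^ α j := by
      refine (le_csSup hbdd ⟨_, ?_, rfl⟩).trans (hle j)
      rw [map_smul_eq_mul, norm_inv, Real.norm_of_nonneg hNx.le, inv_mul_cancel₀ hNx.ne']
    rwa [Matrix.mulVec_smul, map_smul_eq_mul, norm_inv, Real.norm_of_nonneg hNx.le,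
      inv_mul_le_iff₀ hNx, mul_comm] at h1
  have hw : ∀ w x, N ((wordProd A w).mulVec x) ≤ μ ^ wordWeight α w * N x := by
    intro w
    induction w with
    | nil => simp [wordProd_nil, wordWeight_nil]
    | cons j w ih =>
      intro x
      rw [wordProd_cons, ← Matrix.mulVec_mulVec, wordWeight_cons, Real.rpow_add hμ,
        mul_comm (μ ^ α j), mul_assoc]
      exact (ih _).trans (by gcongr; exact hA j x)
  have hnorm : ∀ w, ‖wordProd A w‖ ≤ max 1 (b / a) * μ ^ wordWeight α w := by
    intro w
    refine Matrix.linftyOpNorm_le_of_forall_mulVec_le _ (by positivity) fun x => ?_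
    have h1 : a * ‖(wordProd A w).mulVec x‖ ≤ μ ^ wordWeight α w * (b * ‖x‖) :=
      (hab _).1.trans ((hw w x).trans (by gcongr; exact (hab x).2))
    calc ‖(wordProd A w).mulVec x‖ ≤ μ ^ wordWeight α w * (b * ‖x‖) / a := by
          rwa [le_div_iff₀ ha, mul_comm]
      _ = b / a * μ ^ wordWeight α w * ‖x‖ := by ring
      _ ≤ max 1 (b / a) * μ ^ wordWeight α w * ‖x‖ := by
          gcongr
          exact le_max_right _ _
  obtain ⟨ν, hμν, hν⟩ := exists_between hμlam
  exact (limsup_le_of_le (isCoboundedUnder_rhoSeq A α)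
    (eventually_rhoSeq_le hα (le_max_left _ _) hμ hμν hnorm)).trans_lt hν

/-- **Theorem 2.12 a).** `ρ(𝒜, α) < λ` if and only if there is a norm `N` on
`ℝ^d` for which the induced operator norm of every `A_j` is `< λ^{α_j}`. -/
theorem wjsr_lt_iff_exists_norm {d m : ℕ} (hm : 0 < m)
    (A : Fin m → Matrix (Fin d) (Fin d) ℝ)
    (α : Fin m → ℝ) (hα : ∀ i, 0 < α i) (lam : ℝ) (hlam : 0 < lam) :
    wjsr A α < lam ↔
      ∃ N : Seminorm ℝ (Fin d → ℝ), (∀ x : Fin d → ℝ, x ≠ 0 → 0 < N x) ∧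
        ∀ j : Fin m,
          sSup {c : ℝ | ∃ x : Fin d → ℝ, N x = 1 ∧ c = N ((A j).mulVec x)} <
            lam ^ α j := by
  exact ⟨exists_norm_of_wjsr_lt hα hlam, fun ⟨N, hN, h⟩ => wjsr_lt_of_norm hα hlam N hN h⟩
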